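/- Let K be a field with a field automorphism σ of order 2, F = {λ ∈ K : σ(λ) = λ} its fixed field, V a finite-dimensional K-vector space of dimension at least 2, and h a non-degenerate skew-Hermitian form on V with respect to σ such that V contains a nonzero isotropic vector. Then the F-linear span of {T_v : v ∈ V, h(v,v) = 0} equals the special unitary Lie algebra 𝔰𝔲(V,h) = {x ∈ End_K(V) : trace(x) = 0 and h(x(a),b) + h(a,x(b)) = 0 for all a,b ∈ V} if and only if h is trace-valued. -/

import Mathlib

/-- A skew-Hermitian form on a `K`-vector space `V` with respect to a field automorphism
`σ`: additive in both arguments, `K`-linear in the second argument, `σ`-semilinear in the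
first argument and satisfying `h v w = -σ (h w v)`. -/
structure IsSkewHermitian {K : Type*} [Field K] (σ : K ≃+* K) {V : Type*} [AddCommGroup V]
    [Module K V] (h : V → V → K) : Prop where
  add_left : ∀ u v w : V, h (u + v) w = h u w + h v w
  add_right : ∀ u v w : V, h u (v + w) = h u v + h u w
  smul_left : ∀ (a : K) (v w : V), h (a • v) w = σ a * h v w
  smul_right : ∀ (a : K) (v w : V), h v (a • w) = a * h v w
  skew : ∀ v w : V, h v w = -σ (h w v)

/-- The subfield of `K` of elements fixed by the field automorphism `σ`. -/
def fixedSubfield (K : Type*) [Field K] (σ : K ≃+* K) : Subfield K where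
  carrier := {x | σ x = x}
  mul_mem' := by
    intro a b ha hb
    simp only [Set.mem_setOf_eq] at *
    rw [map_mul, ha, hb]
  one_mem' := map_one σ
  add_mem' := by
    intro a b ha hb
    simp only [Set.mem_setOf_eq] at *
    rw [map_add, ha, hb]
  zero_mem' := map_zero σ
  neg_mem' := by
    intro a ha
    simp only [Set.mem_setOf_eq] at *
    rw [map_neg, ha]
  inv_mem' := by
    intro a ha
    simp only [Set.mem_setOf_eq] at *
    rw [map_inv₀, ha]

/-- For a skew-Hermitian form `h` and `v ∈ V`, the endomorphism `T_v : w ↦ h(v,w) • v`. -/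
def hermT {K : Type*} [Field K] {σ : K ≃+* K} {V : Type*} [AddCommGroup V] [Module K V]
    {h : V → V → K} (hh : IsSkewHermitian σ h) (v : V) : Module.End K V where
  toFun w := h v w • v
  map_add' a b := by
    show h v (a + b) • v = h v a • v + h v b • v
    rw [hh.add_right, add_smul]
  map_smul' c w := by
    show h v (c • w) • v = (RingHom.id K) c • (h v w • v)
    rw [hh.smul_right, RingHom.id_apply, mul_smul]

section FieldInvolution

variable {K : Type*} [Field K] {σ : K ≃+* K}

/-- A nontrivial involution of a field has an element of trace one. -/
theorem exists_add_involution_eq_one (hσ2 : ∀ x, σ (σ x) = x) (hσne : σ ≠ RingEquiv.refl K) :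
    ∃ t : K, t + σ t = 1 := by
  obtain ⟨s, hs⟩ : ∃ s : K, s + σ s ≠ 0 := by
    by_contra! H
    refine hσne (RingEquiv.ext fun x => ?_)
    have h1 := H 1
    have hx := H x
    rw [map_one] at h1
    rw [RingEquiv.refl_apply]
    linear_combination hx - x * h1
  refine ⟨s / (s + σ s), ?_⟩
  rw [map_div₀, map_add, hσ2, add_comm (σ s) s, ← add_div, div_self hs]

/-- Additive Hilbert 90 for a nontrivial field involution. -/
theorem exists_eq_sub_involution (hσ2 : ∀ x, σ (σ x) = x) (hσne : σ ≠ RingEquiv.refl K)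
    {x : K} (hx : x = -σ x) : ∃ a : K, x = a - σ a := by
  obtain ⟨t, ht⟩ := exists_add_involution_eq_one hσ2 hσne
  refine ⟨t * x, ?_⟩
  rw [map_mul]
  linear_combination -x * ht + σ t * hx

end FieldInvolution

namespace IsSkewHermitian

variable {K : Type*} [Field K] {σ : K ≃+* K} {V : Type*} [AddCommGroup V] [Module K V]
  {h : V → V → K}

/-- The linear functional `w ↦ h(v,w)`. -/
def toDual (hh : IsSkewHermitian σ h) (v : V) : V →ₗ[K] K where
  toFun := h v
  map_add' := hh.add_right v
  map_smul' c w := hh.smul_right c v w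

theorem zero_left (hh : IsSkewHermitian σ h) (w : V) : h 0 w = 0 := by
  simpa using hh.smul_left 0 0 w

theorem neg_left (hh : IsSkewHermitian σ h) (v w : V) : h (-v) w = -h v w := by
  simpa using hh.smul_left (-1) v w

theorem neg_right (hh : IsSkewHermitian σ h) (v w : V) : h v (-w) = -h v w := by
  simpa using hh.smul_right (-1) v w

theorem sub_left (hh : IsSkewHermitian σ h) (u v w : V) : h (u - v) w = h u w - h v w := by
  rw [sub_eq_add_neg, hh.add_left, hh.neg_left, sub_eq_add_neg]

theorem sub_right (hh : IsSkewHermitian σ h) (u v w : V) : h u (v - w) = h u v - h u w := by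
  rw [sub_eq_add_neg, hh.add_right, hh.neg_right, sub_eq_add_neg]

theorem sum_left (hh : IsSkewHermitian σ h) {ι : Type*} (s : Finset ι) (v : ι → V) (w : V) :
    h (∑ i ∈ s, v i) w = ∑ i ∈ s, h (v i) w :=
  map_sum (AddMonoidHom.mk' (fun u => h u w) fun a b => hh.add_left a b w) v s

theorem eq_zero_comm (hh : IsSkewHermitian σ h) {v w : V} (hvw : h v w = 0) : h w v = 0 := by
  rw [hh.skew, hvw, map_zero, neg_zero]

/-- A skew-Hermitian form for a nontrivial involution is trace-valued. -/
theorem traceValued (hh : IsSkewHermitian σ h) (hσ2 : ∀ x, σ (σ x) = x)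
    (hσne : σ ≠ RingEquiv.refl K) (v : V) : ∃ a : K, h v v = a - σ a :=
  exists_eq_sub_involution hσ2 hσne (hh.skew v v)

/-- The polarization `x ↦ h(v,x) • w + h(w,x) • v` of `v ↦ T_v`. -/
def polarT (hh : IsSkewHermitian σ h) (v w : V) : Module.End K V :=
  (hh.toDual v).smulRight w + (hh.toDual w).smulRight v

theorem hermT_apply (hh : IsSkewHermitian σ h) (v x : V) : hermT hh v x = h v x • v := rfl

theorem polarT_apply (hh : IsSkewHermitian σ h) (v w x : V) :
    hh.polarT v w x = h v x • w + h w x • v := rfl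

theorem hermT_add (hh : IsSkewHermitian σ h) (v w : V) :
    hermT hh (v + w) = hermT hh v + hermT hh w + hh.polarT v w := by
  ext x
  simp only [LinearMap.add_apply, hermT_apply, polarT_apply, hh.add_left]
  module

theorem polarT_add_right (hh : IsSkewHermitian σ h) (u v w : V) :
    hh.polarT u (v + w) = hh.polarT u v + hh.polarT u w := by
  ext x
  simp only [LinearMap.add_apply, polarT_apply, hh.add_left]
  module

theorem polarT_neg_right (hh : IsSkewHermitian σ h) (v w : V) :
    hh.polarT v (-w) = -hh.polarT v w := by
  ext x
  simp only [LinearMap.neg_apply, polarT_apply, hh.neg_left]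
  module

theorem trace_hermT [FiniteDimensional K V] (hh : IsSkewHermitian σ h) (v : V) :
    LinearMap.trace K V (hermT hh v) = h v v :=
  LinearMap.trace_smulRight (hh.toDual v) v

theorem trace_polarT [FiniteDimensional K V] (hh : IsSkewHermitian σ h) (v w : V) :
    LinearMap.trace K V (hh.polarT v w) = h v w + h w v := by
  rw [polarT, map_add, LinearMap.trace_smulRight, LinearMap.trace_smulRight]
  rfl

/-- The `F`-span of the infinitesimal transvections `T_v`, `v` isotropic. -/
abbrev transvectionSpan (hh : IsSkewHermitian σ h) :
    Submodule (fixedSubfield K σ) (Module.End K V) :=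
  Submodule.span (fixedSubfield K σ)
    {t : Module.End K V | ∃ v : V, h v v = 0 ∧ t = hermT hh v}

theorem hermT_mem (hh : IsSkewHermitian σ h) {v : V} (hv : h v v = 0) :
    hermT hh v ∈ hh.transvectionSpan :=
  Submodule.subset_span ⟨v, hv, rfl⟩

theorem smul_mem_transvectionSpan (hh : IsSkewHermitian σ h) {c : K} (hc : σ c = c)
    {x : Module.End K V} (hx : x ∈ hh.transvectionSpan) : c • x ∈ hh.transvectionSpan :=
  hh.transvectionSpan.smul_mem (⟨c, hc⟩ : fixedSubfield K σ) hx

theorem transvectionSpan_le_su [FiniteDimensional K V] (hh : IsSkewHermitian σ h)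
    {x : Module.End K V} (hx : x ∈ hh.transvectionSpan) :
    LinearMap.trace K V x = 0 ∧ ∀ a b : V, h (x a) b + h a (x b) = 0 := by
  induction hx using Submodule.span_induction with
  | mem x hx =>
    obtain ⟨v, hv, rfl⟩ := hx
    refine ⟨by rw [hh.trace_hermT, hv], fun a b => ?_⟩
    rw [hermT_apply, hermT_apply, hh.smul_left, hh.smul_right, hh.skew a v]
    ring
  | zero =>
    refine ⟨map_zero _, fun a b => ?_⟩
    rw [LinearMap.zero_apply, LinearMap.zero_apply, hh.zero_left,
      hh.eq_zero_comm (hh.zero_left a), add_zero]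
  | add x y _ _ hx hy =>
    refine ⟨by rw [map_add, hx.1, hy.1, add_zero], fun a b => ?_⟩
    rw [LinearMap.add_apply, LinearMap.add_apply, hh.add_left, hh.add_right]
    linear_combination hx.2 a b + hy.2 a b
  | smul c x _ hx =>
    have hc : σ (c : K) = c := c.2
    change LinearMap.trace K V ((c : K) • x) = 0 ∧
      ∀ a b : V, h ((c : K) • x a) b + h a ((c : K) • x b) = 0
    refine ⟨by rw [map_smul, hx.1, smul_zero], fun a b => ?_⟩
    rw [hh.smul_left, hh.smul_right, hc]
    linear_combination (c : K) * hx.2 a b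

/-- Every skew-adjoint endomorphism is a sum of polarizations. -/
theorem exists_eq_sum_polarT [FiniteDimensional K V] (hh : IsSkewHermitian σ h)
    (hσ2 : ∀ x, σ (σ x) = x) (hσne : σ ≠ RingEquiv.refl K)
    (hnd : ∀ v : V, (∀ w : V, h v w = 0) → v = 0) {x : Module.End K V}
    (hx : ∀ a b : V, h (x a) b + h a (x b) = 0) :
    ∃ (n : ℕ) (v w : Fin n → V), x = ∑ i, hh.polarT (v i) (w i) := by
  obtain ⟨t, ht⟩ := exists_add_involution_eq_one hσ2 hσne
  let b := Module.finBasis K V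
  let φ : V →ₗ[K] (Fin (Module.finrank K V) → K) := LinearMap.pi fun i => hh.toDual (b i)
  have hφ : Function.Injective φ := by
    rw [injective_iff_map_eq_zero]
    intro y hy
    refine hnd y fun w => hh.eq_zero_comm ?_
    rw [← b.sum_repr w, hh.sum_left]
    refine Finset.sum_eq_zero fun i _ => ?_
    have hi : h (b i) y = 0 := congrFun hy i
    rw [hh.smul_left, hi, mul_zero]
  let b' := Module.Basis.ofEquivFun (LinearEquiv.ofInjectiveOfFinrankEq φ hφ (by simp))
  have hsum (y : V) : ∑ i, h (b i) y • b' i = y := b'.sum_repr y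
  have hdual (z : V) : ∑ i, h (b' i) z • b i = -z := by
    rw [← sub_eq_zero]
    refine hnd _ fun w => ?_
    rw [hh.sub_left, hh.neg_left, hh.sum_left, hh.skew z w]
    nth_rewrite 2 [← hsum w]
    rw [hh.sum_left, map_sum, sub_neg_eq_add, ← sub_eq_add_neg, sub_eq_zero]
    refine Finset.sum_congr rfl fun i _ => ?_
    rw [hh.smul_left, hh.smul_left, map_mul, hσ2, mul_comm]
  refine ⟨_, b, fun i => t • x (b' i), LinearMap.ext fun y => ?_⟩
  have h1 : ∑ i, h (b i) y • t • x (b' i) = t • x y := by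
    conv_rhs => rw [← hsum y, map_sum, Finset.smul_sum]
    refine Finset.sum_congr rfl fun i _ => ?_
    rw [map_smul, smul_comm]
  have h2 : ∑ i, h (t • x (b' i)) y • b i = σ t • x y := by
    have : x y = -∑ i, h (b' i) (x y) • b i := by rw [hdual, neg_neg]
    rw [this, ← Finset.sum_neg_distrib, Finset.smul_sum]
    refine Finset.sum_congr rfl fun i _ => ?_
    rw [hh.smul_left, eq_neg_of_add_eq_zero_left (hx (b' i) y)]
    module
  rw [LinearMap.sum_apply]
  simp only [polarT_apply]
  rw [Finset.sum_add_distrib, h1, h2, ← add_smul, ht, one_smul]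

/-- A nonzero isotropic vector extends to a hyperbolic pair. -/
theorem exists_hyperbolic_pair (hh : IsSkewHermitian σ h) (hσ2 : ∀ x, σ (σ x) = x)
    (hσne : σ ≠ RingEquiv.refl K) (hnd : ∀ v : V, (∀ w : V, h v w = 0) → v = 0)
    {e : V} (he0 : e ≠ 0) (he : h e e = 0) : ∃ f : V, h f f = 0 ∧ h e f = 1 := by
  obtain ⟨w, hw⟩ : ∃ w, h e w ≠ 0 := by
    by_contra! H
    exact he0 (hnd e H)
  set g := (h e w)⁻¹ • w
  have heg : h e g = 1 := by rw [hh.smul_right, inv_mul_cancel₀ hw]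
  have hge : h g e = -1 := by rw [hh.skew, heg, map_one]
  obtain ⟨c, hc⟩ := hh.traceValued hσ2 hσne g
  refine ⟨g + c • e, ?_, ?_⟩
  · simp only [hh.add_left, hh.add_right, hh.smul_left, hh.smul_right, he, heg, hge, hc]
    ring
  · rw [hh.add_right, hh.smul_right c, he, heg, mul_zero, add_zero]

theorem hermT_hyperbolic_add (hh : IsSkewHermitian σ h) (hσ2 : ∀ x, σ (σ x) = x)
    (e f w : V) (a b : K) :
    hermT hh (a • e + b • f + w) =
      (a * σ a) • hermT hh e + (b * σ b) • hermT hh f + hermT hh w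
        + hh.polarT e ((σ a * b) • f) + hh.polarT e (σ a • w) + hh.polarT f (σ b • w) := by
  ext x
  simp only [LinearMap.add_apply, LinearMap.smul_apply, hermT_apply, polarT_apply, hh.add_left,
    hh.smul_left, map_mul, hσ2]
  module

section HyperbolicPair

variable {e f : V}

theorem smul_hermT_mem (hh : IsSkewHermitian σ h) (hσ2 : ∀ x, σ (σ x) = x) (he : h e e = 0)
    (a : K) : (a * σ a) • hermT hh e ∈ hh.transvectionSpan :=
  hh.smul_mem_transvectionSpan (by rw [map_mul, hσ2, mul_comm]) (hh.hermT_mem he)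

theorem polarT_mem_of_hyperbolic (hh : IsSkewHermitian σ h) (he : h e e = 0) (hf : h f f = 0)
    (hef : h e f = 1) : hh.polarT e f ∈ hh.transvectionSpan := by
  have hfe : h f e = -1 := by rw [hh.skew, hef, map_one]
  have hsum : h (e + f) (e + f) = 0 := by
    simp only [hh.add_left, hh.add_right, he, hf, hef, hfe]
    ring
  have := sub_mem (hh.hermT_mem hsum) (add_mem (hh.hermT_mem he) (hh.hermT_mem hf))
  rwa [hh.hermT_add, add_sub_cancel_left] at this

theorem isotropic_of_orthogonal (hh : IsSkewHermitian σ h) (he : h e e = 0) (hf : h f f = 0)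
    (hef : h e f = 1) {w : V} (hew : h e w = 0) (hfw : h f w = 0) {c : K}
    (hc : h w w = c - σ c) : h (c • e + (1 : K) • f + w) (c • e + (1 : K) • f + w) = 0 := by
  have hfe : h f e = -1 := by rw [hh.skew, hef, map_one]
  simp only [hh.add_left, hh.add_right, hh.smul_left, hh.smul_right, he, hf, hef, hfe, hew, hfw,
    hh.eq_zero_comm hew, hh.eq_zero_comm hfw, hc, map_one]
  ring

theorem polarT_mem_of_orthogonal (hh : IsSkewHermitian σ h) (hσ2 : ∀ x, σ (σ x) = x)
    (hσne : σ ≠ RingEquiv.refl K) (he : h e e = 0) (hf : h f f = 0) (hef : h e f = 1)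
    {w : V} (hew : h e w = 0) (hfw : h f w = 0) : hh.polarT e w ∈ hh.transvectionSpan := by
  obtain ⟨c, hc⟩ := hh.traceValued hσ2 hσne w
  have hc' : h w w = (c + 1) - σ (c + 1) := by rw [hc, map_add, map_one]; ring
  have key := sub_mem (sub_mem
    (sub_mem (hh.hermT_mem (hh.isotropic_of_orthogonal he hf hef hew hfw hc'))
      (hh.hermT_mem (hh.isotropic_of_orthogonal he hf hef hew hfw hc)))
    (hh.polarT_mem_of_hyperbolic he hf hef))
    (sub_mem (hh.smul_hermT_mem hσ2 he (c + 1)) (hh.smul_hermT_mem hσ2 he c))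
  convert key using 1
  rw [hh.hermT_hyperbolic_add hσ2, hh.hermT_hyperbolic_add hσ2]
  ext x
  simp only [LinearMap.add_apply, LinearMap.sub_apply, LinearMap.smul_apply, hermT_apply,
    polarT_apply, hh.smul_left, map_mul, map_add, map_one, hσ2]
  module

theorem polarT_mem_of_orthogonal' (hh : IsSkewHermitian σ h) (hσ2 : ∀ x, σ (σ x) = x)
    (hσne : σ ≠ RingEquiv.refl K) (he : h e e = 0) (hf : h f f = 0) (hef : h e f = 1)
    {w : V} (hew : h e w = 0) (hfw : h f w = 0) : hh.polarT f w ∈ hh.transvectionSpan := by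
  refine hh.polarT_mem_of_orthogonal (f := -e) hσ2 hσne hf ?_ ?_ hfw ?_
  · rw [hh.neg_left, hh.neg_right, he, neg_zero, neg_zero]
  · rw [hh.neg_right, hh.skew, hef, map_one, neg_neg]
  · rw [hh.neg_left, hew, neg_zero]

/-- Modulo the span of the transvections, `T_w` for `w` orthogonal to a hyperbolic pair is
supported on that pair. -/
theorem exists_hermT_sub_polarT_mem_of_orthogonal (hh : IsSkewHermitian σ h)
    (hσ2 : ∀ x, σ (σ x) = x) (hσne : σ ≠ RingEquiv.refl K) (he : h e e = 0) (hf : h f f = 0)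
    (hef : h e f = 1) {w : V} (hw : h e w = 0 ∧ h f w = 0) :
    ∃ d : K, hermT hh w - hh.polarT e (d • f) ∈ hh.transvectionSpan := by
  have orth (c : K) : h e (c • w) = 0 ∧ h f (c • w) = 0 := by
    simp only [hh.smul_right, hw.1, hw.2, mul_zero, and_self]
  obtain ⟨c, hc⟩ := hh.traceValued hσ2 hσne w
  refine ⟨-σ c, ?_⟩
  convert sub_mem (hh.hermT_mem (hh.isotropic_of_orthogonal he hf hef hw.1 hw.2 hc))
    (add_mem (add_mem (hh.smul_hermT_mem hσ2 he c) (hh.smul_hermT_mem hσ2 hf 1))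
      (add_mem (hh.polarT_mem_of_orthogonal hσ2 hσne he hf hef (orth (σ c)).1 (orth (σ c)).2)
        (hh.polarT_mem_of_orthogonal' hσ2 hσne he hf hef (orth (σ 1)).1 (orth (σ 1)).2)))
    using 1
  rw [hh.hermT_hyperbolic_add hσ2, neg_smul, hh.polarT_neg_right, mul_one]
  abel

/-- Modulo the span of the transvections, every `T_v` is supported on a hyperbolic pair. -/
theorem exists_hermT_sub_polarT_mem (hh : IsSkewHermitian σ h)
    (hσ2 : ∀ x, σ (σ x) = x) (hσne : σ ≠ RingEquiv.refl K) (he : h e e = 0) (hf : h f f = 0)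
    (hef : h e f = 1) (v : V) :
    ∃ d : K, hermT hh v - hh.polarT e (d • f) ∈ hh.transvectionSpan := by
  have hfe : h f e = -1 := by rw [hh.skew, hef, map_one]
  obtain ⟨a, b, w, hew, hfw, rfl⟩ : ∃ (a b : K) (w : V), h e w = 0 ∧ h f w = 0 ∧
      v = a • e + b • f + w := by
    refine ⟨-h f v, h e v, v - ((-h f v) • e + h e v • f), ?_, ?_, by abel⟩ <;>
    · simp only [hh.sub_right, hh.add_right, hh.smul_right, he, hf, hef, hfe]
      ring
  have orth (c : K) : h e (c • w) = 0 ∧ h f (c • w) = 0 := by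
    simp only [hh.smul_right, hew, hfw, mul_zero, and_self]
  obtain ⟨d, hd⟩ := hh.exists_hermT_sub_polarT_mem_of_orthogonal hσ2 hσne he hf hef ⟨hew, hfw⟩
  refine ⟨σ a * b + d, ?_⟩
  convert add_mem hd
    (add_mem (add_mem (hh.smul_hermT_mem hσ2 he a) (hh.smul_hermT_mem hσ2 hf b))
      (add_mem (hh.polarT_mem_of_orthogonal hσ2 hσne he hf hef (orth (σ a)).1 (orth (σ a)).2)
        (hh.polarT_mem_of_orthogonal' hσ2 hσne he hf hef (orth (σ b)).1 (orth (σ b)).2)))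
    using 1
  rw [hh.hermT_hyperbolic_add hσ2, add_smul, hh.polarT_add_right]
  abel

/-- Modulo the span of the transvections, every sum of polarizations is supported on a
hyperbolic pair. -/
theorem exists_sum_polarT_sub_polarT_mem (hh : IsSkewHermitian σ h)
    (hσ2 : ∀ x, σ (σ x) = x) (hσne : σ ≠ RingEquiv.refl K) (he : h e e = 0) (hf : h f f = 0)
    (hef : h e f = 1) {ι : Type*} (s : Finset ι) (v w : ι → V) :
    ∃ d : K, ∑ i ∈ s, hh.polarT (v i) (w i) - hh.polarT e (d • f) ∈ hh.transvectionSpan := by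
  refine Finset.sum_induction (fun i => hh.polarT (v i) (w i))
    (fun x => ∃ d : K, x - hh.polarT e (d • f) ∈ hh.transvectionSpan) ?_ ?_ ?_
  · rintro x y ⟨d, hd⟩ ⟨d', hd'⟩
    refine ⟨d + d', ?_⟩
    convert add_mem hd hd' using 1
    rw [add_smul, hh.polarT_add_right]
    abel
  · refine ⟨0, ?_⟩
    have : hh.polarT e ((0 : K) • f) = 0 := by
      ext x
      simp [polarT_apply, hh.zero_left]
    rw [this, sub_zero]
    exact zero_mem _
  · intro i _
    obtain ⟨d, hd⟩ := hh.exists_hermT_sub_polarT_mem hσ2 hσne he hf hef (v i + w i)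
    obtain ⟨d₁, hd₁⟩ := hh.exists_hermT_sub_polarT_mem hσ2 hσne he hf hef (v i)
    obtain ⟨d₂, hd₂⟩ := hh.exists_hermT_sub_polarT_mem hσ2 hσne he hf hef (w i)
    refine ⟨d + -d₁ + -d₂, ?_⟩
    convert sub_mem (sub_mem hd hd₁) hd₂ using 1
    rw [hh.hermT_add, add_smul, add_smul, hh.polarT_add_right, hh.polarT_add_right, neg_smul,
      neg_smul, hh.polarT_neg_right, hh.polarT_neg_right]
    abel

end HyperbolicPair

theorem su_le_transvectionSpan [FiniteDimensional K V] (hh : IsSkewHermitian σ h)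
    (hσ2 : ∀ x, σ (σ x) = x) (hσne : σ ≠ RingEquiv.refl K)
    (hnd : ∀ v : V, (∀ w : V, h v w = 0) → v = 0) (hiso : ∃ v : V, v ≠ 0 ∧ h v v = 0)
    {x : Module.End K V} (htr : LinearMap.trace K V x = 0)
    (hx : ∀ a b : V, h (x a) b + h a (x b) = 0) : x ∈ hh.transvectionSpan := by
  obtain ⟨e, he0, he⟩ := hiso
  obtain ⟨f, hf, hef⟩ := hh.exists_hyperbolic_pair hσ2 hσne hnd he0 he
  obtain ⟨n, v, w, hsum⟩ := hh.exists_eq_sum_polarT hσ2 hσne hnd hx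
  obtain ⟨d, hd⟩ := hh.exists_sum_polarT_sub_polarT_mem hσ2 hσne he hf hef Finset.univ v w
  rw [← hsum] at hd
  have hfe : h f e = -1 := by rw [hh.skew, hef, map_one]
  have hdσ : σ d = d := by
    have := (hh.transvectionSpan_le_su hd).1
    rw [map_sub, htr, hh.trace_polarT, hh.smul_right, hh.smul_left, hef, hfe] at this
    linear_combination this
  have hpol : hh.polarT e (d • f) = d • hh.polarT e f := by
    ext x
    simp only [LinearMap.smul_apply, polarT_apply, hh.smul_left, hdσ]
    module
  rw [hpol] at hd
  simpa using add_mem hd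
    (hh.smul_mem_transvectionSpan hdσ (hh.polarT_mem_of_hyperbolic he hf hef))

end IsSkewHermitian

/-- For a non-degenerate skew-Hermitian form `h` on a finite-dimensional space of
dimension at least 2 containing a nonzero isotropic vector, the `F`-linear span of the
infinitesimal transvections `T_v` (`v` isotropic) equals the special unitary Lie algebra
`su(V,h)` if and only if `h` is trace-valued. -/
theorem span_transvections_eq_su_iff_traceValued (K : Type*) [Field K]
    (σ : K ≃+* K) (hσ2 : ∀ x, σ (σ x) = x) (hσne : σ ≠ RingEquiv.refl K)
    (V : Type*) [AddCommGroup V] [Module K V] [FiniteDimensional K V]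
    (hdim : 2 ≤ Module.finrank K V)
    (h : V → V → K) (hherm : IsSkewHermitian σ h)
    (hnd : ∀ v : V, (∀ w : V, h v w = 0) → v = 0)
    (hiso : ∃ v : V, v ≠ 0 ∧ h v v = 0) :
    (Submodule.span (fixedSubfield K σ)
          {t : Module.End K V | ∃ v : V, h v v = 0 ∧ t = hermT hherm v} :
        Set (Module.End K V)) =
      {x : Module.End K V | LinearMap.trace K V x = 0 ∧
        ∀ a b : V, h (x a) b + h a (x b) = 0} ↔
      ∀ v : V, ∃ a : K, h v v = a - σ a := by
  refine ⟨fun _ => hherm.traceValued hσ2 hσne, fun _ => Set.ext fun x => ⟨?_, ?_⟩⟩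
  · exact fun hx => hherm.transvectionSpan_le_su hx
  · exact fun hx => hherm.su_le_transvectionSpan hσ2 hσne hnd hiso hx.1 hx.2
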